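/- Let 𝒟 be a triangulated category and let the operation * on isomorphism classes of objects be defined by: [Z] ∈ 𝒳 * 𝒴 if there exists a distinguished triangle X → Z → Y → with [X] ∈ 𝒳 and [Y] ∈ 𝒴. Then * is associative: (𝒳 * 𝒴) * 𝒵 = 𝒳 * (𝒴 * 𝒵) for all sets of isomorphism classes 𝒳, 𝒴, 𝒵. -/

import Mathlib

open CategoryTheory CategoryTheory.Pretriangulated

/-- The `*` operation on isomorphism-closed classes of objects of a triangulated
category: `Z ∈ 𝒳 * 𝒴` iff there is a distinguished triangle `X ⟶ Z ⟶ Y ⟶` with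
`X ∈ 𝒳` and `Y ∈ 𝒴` (cf. [BBD, §1.3.9]). -/
def starOp {D : Type*} [Category D] [Limits.HasZeroObject D] [Preadditive D]
    [HasShift D ℤ] [∀ n : ℤ, (shiftFunctor D n).Additive] [Pretriangulated D]
    (𝒳 𝒴 : Set D) : Set D :=
  {Z | ∃ (X Y : D) (f : X ⟶ Z) (g : Z ⟶ Y) (h : Y ⟶ X⟦(1 : ℤ)⟧),
    (Triangle.mk f g h ∈ distTriang D) ∧ X ∈ 𝒳 ∧ Y ∈ 𝒴}

/-- [BBD, §1.3.9]: the `*` operation on classes of objects closed under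
isomorphism in a triangulated category is associative. -/
theorem starOp_assoc
    (D : Type*) [Category D] [Limits.HasZeroObject D] [Preadditive D]
    [HasShift D ℤ] [∀ n : ℤ, (shiftFunctor D n).Additive] [Pretriangulated D]
    [IsTriangulated D]
    (𝒳 𝒴 𝒵 : Set D)
    (hX : ∀ ⦃X Y : D⦄, (X ≅ Y) → X ∈ 𝒳 → Y ∈ 𝒳)
    (hY : ∀ ⦃X Y : D⦄, (X ≅ Y) → X ∈ 𝒴 → Y ∈ 𝒴)
    (hZ : ∀ ⦃X Y : D⦄, (X ≅ Y) → X ∈ 𝒵 → Y ∈ 𝒵) :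
    starOp (starOp 𝒳 𝒴) 𝒵 = starOp 𝒳 (starOp 𝒴 𝒵) := by
  ext W
  constructor
  · rintro ⟨V, Z, f, g, h, hW, ⟨X, Y, f', g', h', hV, hX, hY⟩, hZ⟩
    obtain ⟨U, p, q, hU⟩ := distinguished_cocone_triangle (f' ≫ f)
    exact ⟨X, U, f' ≫ f, p, q, hU, hX, Y, Z, _, _, _,
      (Triangulated.someOctahedron rfl hV hW hU).mem, hY, hZ⟩
  · rintro ⟨X, V, f, g, h, hW, hX, ⟨Y, Z, f', g', h', hV, hY, hZ⟩⟩
    obtain ⟨U, p, q, hU⟩ := distinguished_cocone_triangle₁ (g ≫ g')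
    exact ⟨U, Z, p, g ≫ g', q, hU, ⟨X, Y, _, _, _,
      (Triangulated.someOctahedron' rfl hW hV hU).mem, hX, hY⟩, hZ⟩
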